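/- Assume f is (L0,Lq)-smooth, 0 ≤ β1 < β2 < 1, η = C̃0·√(1−β2) with η ≤ 1/(Lq·F) where F = √(4d/(β2(1−β1)²(1−β2)(1−β1/β2))), and the noise bound event holds: for all s ∈ [T], ‖ξ_s‖² ≤ M_T²·(σ0² + σ1²‖ḡ_s‖^p). Then for all t ∈ [T] and i ∈ [d]: F_i(t) ≤ J(t) := 1 + (2M_T²/ε²)·[ σ0²·t + σ1²·t·(‖ḡ_1‖ + t·M̃_t)^p + t·(‖ḡ_1‖ + t·M̃_t)² ], where M̃_t = C̃0·L^{(x)}_t·√(d/(1−β1/β2)), L^{(x)}_t = L0 + Lq·G_t^q, G_t = max_{j∈[t]}‖ḡ_j‖, and F_i(t) = 1 + (1/ε²)·Σ_{s=1}^t g_{s,i}². -/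

import Mathlib

/-- Squared exponential moving average against the moving average of squares: Cauchy–Schwarz for
the weights `β1 ^ (s - j)`, together with `β1 ≤ β2`. -/
theorem sq_ema_le {β1 β2 : ℝ} (hβ1 : 0 ≤ β1) (hβ12 : β1 ≤ β2) (hβ2 : β2 < 1)
    {m v g : ℕ → ℝ} (hm0 : m 0 = 0) (hv0 : v 0 = 0)
    (hm : ∀ s, m (s + 1) = β1 * m s + (1 - β1) * g (s + 1))
    (hv : ∀ s, v (s + 1) = β2 * v s + (1 - β2) * g (s + 1) ^ 2) (s : ℕ) :
    (1 - β2) * m s ^ 2 ≤ (1 - β1) * (1 - β1 ^ s) * v s := by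
  have hβ1' : β1 < 1 := hβ12.trans_lt hβ2
  have hpow (s : ℕ) : 0 ≤ 1 - β1 ^ s := sub_nonneg.2 (pow_le_one₀ hβ1 hβ1'.le)
  obtain ⟨u, -, hmu, huv⟩ : ∃ u, 0 ≤ u ∧ m s ^ 2 ≤ (1 - β1 ^ s) * u ∧
      (1 - β2) * u ≤ (1 - β1) * v s := by
    induction s with
    | zero => exact ⟨0, by simp [hm0, hv0]⟩
    | succ s ih =>
      obtain ⟨u, hu, hmu, huv⟩ := ih
      have hv_nonneg : 0 ≤ v s := by
        have : 0 ≤ (1 - β1) * v s := le_trans (mul_nonneg (by linarith) hu) huv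
        exact nonneg_of_mul_nonneg_right this (by linarith)
      have hcross : 2 * (m s * g (s + 1)) ≤ (1 - β1 ^ s) * g (s + 1) ^ 2 + u := by
        refine le_of_abs_le (abs_le_of_sq_le_sq ?_ ?_)
        · have := mul_le_mul_of_nonneg_right hmu (sq_nonneg (g (s + 1)))
          nlinarith [sq_nonneg ((1 - β1 ^ s) * g (s + 1) ^ 2 - u)]
        · have := mul_nonneg (hpow s) (sq_nonneg (g (s + 1)))
          linarith
      refine ⟨β1 * u + (1 - β1) * g (s + 1) ^ 2, ?_, ?_, ?_⟩
      · have := mul_nonneg hβ1 hu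
        have := mul_nonneg (sub_nonneg.2 hβ1'.le) (sq_nonneg (g (s + 1)))
        linarith
      · have h1 := mul_le_mul_of_nonneg_left hmu (sq_nonneg β1)
        have h2 := mul_le_mul_of_nonneg_left hcross (mul_nonneg hβ1 (sub_nonneg.2 hβ1'.le))
        rw [hm, pow_succ]
        linear_combination h1 + h2
      · have h1 := mul_le_mul_of_nonneg_left huv hβ1
        have h2 := mul_nonneg (mul_nonneg (sub_nonneg.2 hβ12) hv_nonneg)
          (sub_nonneg.2 hβ1'.le)
        rw [hv]
        linear_combination h1 + h2
  have h1 := mul_le_mul_of_nonneg_left hmu (sub_nonneg.2 hβ2.le)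
  have h2 := mul_le_mul_of_nonneg_left huv (hpow s)
  linear_combination h1 + h2

/-- An Adam step with `η = c √(1 - β2)` moves every coordinate by at most `c`. -/
theorem abs_adam_step_le {β1 β2 ε c : ℝ} (hβ1 : 0 ≤ β1) (hβ12 : β1 ≤ β2) (hβ2 : β2 < 1)
    (hε : 0 < ε) (hc : 0 ≤ c) {m v g : ℕ → ℝ} (hm0 : m 0 = 0) (hv0 : v 0 = 0)
    (hm : ∀ s, m (s + 1) = β1 * m s + (1 - β1) * g (s + 1))
    (hv : ∀ s, v (s + 1) = β2 * v s + (1 - β2) * g (s + 1) ^ 2) {s : ℕ} (hs : 1 ≤ s) :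
    |c * √(1 - β2) * √(1 - β2 ^ s) / (1 - β1 ^ s) * m s /
      (√(v s) + ε * √(1 - β2 ^ s))| ≤ c := by
  have hβ1' : β1 < 1 := hβ12.trans_lt hβ2
  have hβ2' : 0 ≤ β2 := hβ1.trans hβ12
  have hs0 : s ≠ 0 := by omega
  have hpow1 : 0 < 1 - β1 ^ s := sub_pos.2 (pow_lt_one₀ hβ1 hβ1' hs0)
  have hpow1' : 1 - β1 ≤ 1 - β1 ^ s :=
    sub_le_sub_left (pow_le_of_le_one hβ1 hβ1'.le hs0) 1
  have hpow2 : 0 < 1 - β2 ^ s := sub_pos.2 (pow_lt_one₀ hβ2' hβ2 hs0)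
  have hpow2' : 1 - β2 ^ s ≤ 1 := sub_le_self 1 (pow_nonneg hβ2' s)
  have hv_nonneg : 0 ≤ v s := by
    clear hs hs0 hpow1 hpow1' hpow2 hpow2'
    induction s with
    | zero => simp [hv0]
    | succ s ih =>
      rw [hv]
      exact add_nonneg (mul_nonneg hβ2' ih) (mul_nonneg (sub_nonneg.2 hβ2.le) (sq_nonneg _))
  have hb : 0 < √(v s) + ε * √(1 - β2 ^ s) := by positivity
  have hkey : √(1 - β2) * √(1 - β2 ^ s) * |m s| ≤ √(v s) * (1 - β1 ^ s) := by
    refine le_of_sq_le_sq ?_ (by positivity)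
    rw [mul_pow, mul_pow, mul_pow, Real.sq_sqrt hpow2.le, Real.sq_sqrt (sub_nonneg.2 hβ2.le),
      Real.sq_sqrt hv_nonneg, sq_abs]
    calc (1 - β2) * (1 - β2 ^ s) * m s ^ 2
        ≤ (1 - β2) * 1 * m s ^ 2 := by gcongr
      _ = (1 - β2) * m s ^ 2 := by ring
      _ ≤ (1 - β1) * (1 - β1 ^ s) * v s := sq_ema_le hβ1 hβ12 hβ2 hm0 hv0 hm hv s
      _ ≤ (1 - β1 ^ s) * (1 - β1 ^ s) * v s := by gcongr
      _ = v s * (1 - β1 ^ s) ^ 2 := by ring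
  rw [abs_div, abs_mul, abs_div, abs_of_pos hb, abs_of_pos hpow1, div_le_iff₀ hb,
    abs_of_nonneg (by positivity), div_mul_eq_mul_div, div_le_iff₀ hpow1]
  calc c * √(1 - β2) * √(1 - β2 ^ s) * |m s|
      = c * (√(1 - β2) * √(1 - β2 ^ s) * |m s|) := by ring
    _ ≤ c * (√(v s) * (1 - β1 ^ s)) := by gcongr
    _ ≤ c * (√(v s) + ε * √(1 - β2 ^ s)) * (1 - β1 ^ s) := by
      rw [mul_assoc]
      gcongr
      exact le_add_of_nonneg_right (by positivity)

theorem EuclideanSpace.norm_le_sqrt_card_mul {d : ℕ} {c : ℝ} (hc : 0 ≤ c)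
    {y : EuclideanSpace ℝ (Fin d)} (h : ∀ i, |y i| ≤ c) : ‖y‖ ≤ √d * c := by
  rw [EuclideanSpace.norm_eq]
  refine Real.sqrt_le_iff.2 ⟨by positivity, ?_⟩
  calc ∑ i, ‖y i‖ ^ 2 ≤ ∑ _i : Fin d, c ^ 2 := Finset.sum_le_sum fun i _ => by
        rw [Real.norm_eq_abs]
        exact pow_le_pow_left₀ (abs_nonneg _) (h i) 2
    _ = (√d * c) ^ 2 := by
        rw [mul_pow, Real.sq_sqrt (Nat.cast_nonneg d)]
        simp

theorem le_biSup_finset_of_nonneg {ι : Type*} {a : ι → ℝ} (ha : ∀ i, 0 ≤ a i) (s : Finset ι)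
    {i : ι} (hi : i ∈ s) : a i ≤ ⨆ j ∈ s, a j := by
  have hbdd : BddAbove (Set.range fun j => ⨆ _ : j ∈ s, a j) := by
    refine ⟨∑ k ∈ s, a k, ?_⟩
    rintro _ ⟨j, rfl⟩
    refine Real.iSup_le (fun hj => ?_) (Finset.sum_nonneg fun k _ => ha k)
    exact Finset.single_le_sum (fun k _ => ha k) hj
  refine le_trans ?_ (le_ciSup hbdd i)
  simp [hi]

/-- Sequences with increments at most `D` in norm. -/
theorem norm_le_add_mul_of_norm_sub_le {E : Type*} [SeminormedAddCommGroup E] {y : ℕ → E}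
    {D : ℝ} {t : ℕ} (h : ∀ s, 1 ≤ s → s < t → ‖y (s + 1) - y s‖ ≤ D) {s : ℕ} (hs : 1 ≤ s)
    (hst : s ≤ t) : ‖y s‖ ≤ ‖y 1‖ + (s - 1) * D := by
  induction s, hs using Nat.le_induction with
  | base => simp
  | succ s hs ih =>
    have h1 := ih (by omega)
    have h2 := h s hs (by omega)
    have h3 := norm_sub_norm_le (y (s + 1)) (y s)
    push_cast
    linarith

theorem stmt_19
    (d T : ℕ) (hd : 1 ≤ d) (hT : 1 ≤ T)
    (β1 β2 η ε : ℝ)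
    (hβ1 : 0 ≤ β1) (hβ12 : β1 < β2) (hβ2 : β2 < 1)
    (hη : 0 < η) (hε : 0 < ε)
    (q L0 Lq : ℝ) (hq0 : 0 ≤ q) (hq2 : q < 2) (hL0 : 0 < L0) (hLq : 0 < Lq)
    (f : EuclideanSpace ℝ (Fin d) → ℝ) (hdiff : Differentiable ℝ f)
    (hsmooth : ∀ z w : EuclideanSpace ℝ (Fin d), ‖z - w‖ ≤ 1 / Lq →
      ‖gradient f w - gradient f z‖ ≤ (L0 + Lq * ‖gradient f z‖ ^ q) * ‖z - w‖)
    (tC0 : ℝ) (htC0 : 0 < tC0) (hηC0 : η = tC0 * Real.sqrt (1 - β2))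
    (hηF : η ≤ 1 / (Lq * Real.sqrt (4 * d / (β2 * (1 - β1) ^ 2 * (1 - β2) * (1 - β1 / β2)))))
    (g m v x : ℕ → EuclideanSpace ℝ (Fin d))
    (hm0 : m 0 = 0) (hv0 : v 0 = 0)
    (hm : ∀ s, 1 ≤ s → ∀ i, m s i = β1 * m (s - 1) i + (1 - β1) * g s i)
    (hv : ∀ s, 1 ≤ s → ∀ i, v s i = β2 * v (s - 1) i + (1 - β2) * (g s i) ^ 2)
    (ηs : ℕ → ℝ) (hηs : ∀ s, 1 ≤ s → ηs s = η * Real.sqrt (1 - β2 ^ s) / (1 - β1 ^ s))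
    (b : ℕ → Fin d → ℝ)
    (hb : ∀ s i, b s i = Real.sqrt (v s i) + ε * Real.sqrt (1 - β2 ^ s))
    (hx : ∀ s, 1 ≤ s → ∀ i, x (s + 1) i = x s i - ηs s * m s i / b s i)
    (ξ : ℕ → EuclideanSpace ℝ (Fin d))
    (hξ : ∀ s, ξ s = g s - gradient f (x s))
    (σ0 σ1 p : ℝ) (hσ0 : 0 < σ0) (hσ1 : 0 < σ1) (hp0 : 0 ≤ p) (hp4 : p < 4)
    (δ : ℝ) (hδ0 : 0 < δ) (hδ1 : δ < 1)
    (MT : ℝ) (hMT : MT = Real.sqrt (Real.log (Real.exp 1 * T / δ)))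
    (hnoise : ∀ s ∈ Finset.Icc 1 T,
      ‖ξ s‖ ^ 2 ≤ MT ^ 2 * (σ0 ^ 2 + σ1 ^ 2 * ‖gradient f (x s)‖ ^ p))
    (G : ℕ → ℝ) (hG : ∀ t, G t = ⨆ j ∈ Finset.Icc 1 t, ‖gradient f (x j)‖)
    (Lx : ℕ → ℝ) (hLx : ∀ t, Lx t = L0 + Lq * (G t) ^ q)
    (Mt : ℕ → ℝ) (hMt : ∀ t, Mt t = tC0 * Lx t * Real.sqrt (d / (1 - β1 / β2))) :
    ∀ t ∈ Finset.Icc 1 T, ∀ i : Fin d,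
      1 + (1 / ε ^ 2) * ∑ s ∈ Finset.Icc 1 t, (g s i) ^ 2 ≤
        1 + (2 * MT ^ 2 / ε ^ 2) *
          (σ0 ^ 2 * t + σ1 ^ 2 * t * (‖gradient f (x 1)‖ + t * Mt t) ^ p +
            t * (‖gradient f (x 1)‖ + t * Mt t) ^ 2) := by
  intro t ht i
  obtain ⟨ht1, htT⟩ := Finset.mem_Icc.1 ht
  have hβ2_pos : 0 < β2 := hβ1.trans_lt hβ12
  have hβ1_lt : β1 < 1 := hβ12.trans hβ2
  have hr0 : 0 ≤ β1 / β2 := by positivity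
  have hr : 0 < 1 - β1 / β2 := sub_pos.2 ((div_lt_one hβ2_pos).2 hβ12)
  have hd' : (1 : ℝ) ≤ d := by exact_mod_cast hd
  set R : ℝ := √(d / (1 - β1 / β2)) with hR
  have hcoord : ∀ s, 1 ≤ s → ∀ i, |(x (s + 1) - x s) i| ≤ tC0 := by
    intro s hs i
    have := abs_adam_step_le hβ1 hβ12.le hβ2 hε htC0.le
      (m := fun s => m s i) (v := fun s => v s i) (g := fun s => g s i)
      (by simp [hm0]) (by simp [hv0])
      (fun s => by simpa using hm (s + 1) (by omega) i)
      (fun s => by simpa using hv (s + 1) (by omega) i) hs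
    rw [PiLp.sub_apply, hx s hs, hηs s hs, hb, hηC0, sub_sub_cancel_left, abs_neg]
    exact this
  have hstep : ∀ s, 1 ≤ s → ‖x (s + 1) - x s‖ ≤ tC0 * R := by
    intro s hs
    refine (EuclideanSpace.norm_le_sqrt_card_mul htC0.le (hcoord s hs)).trans ?_
    rw [mul_comm]
    exact mul_le_mul_of_nonneg_left
      (Real.sqrt_le_sqrt (le_div_self (by positivity) hr (sub_le_self 1 hr0))) htC0.le
  have hradius : tC0 * R ≤ 1 / Lq := by
    set Q : ℝ := 4 * d / (β2 * (1 - β1) ^ 2 * (1 - β2) * (1 - β1 / β2)) with hQ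
    have h1β1 : 0 < 1 - β1 := sub_pos.2 hβ1_lt
    have h1β2 : 0 < 1 - β2 := sub_pos.2 hβ2
    have hQ_pos : 0 < Q := by positivity
    have hle : R ≤ √(1 - β2) * √Q := by
      rw [← Real.sqrt_mul h1β2.le, hR]
      refine Real.sqrt_le_sqrt ?_
      have hden : β2 * (1 - β1) ^ 2 ≤ 1 :=
        mul_le_one₀ hβ2.le (by positivity) (pow_le_one₀ h1β1.le (by linarith))
      rw [hQ, div_le_iff₀ hr]
      have : (1 - β2) * (4 * d / (β2 * (1 - β1) ^ 2 * (1 - β2) * (1 - β1 / β2))) *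
          (1 - β1 / β2) = 4 * d / (β2 * (1 - β1) ^ 2) := by
        generalize 1 - β1 / β2 = r at hr
        field_simp
      rw [this, le_div_iff₀ (by positivity)]
      nlinarith
    rw [hηC0, le_div_iff₀ (by positivity)] at hηF
    rw [le_div_iff₀ hLq]
    calc tC0 * R * Lq ≤ tC0 * (√(1 - β2) * √Q) * Lq := by gcongr
      _ = tC0 * √(1 - β2) * (Lq * √Q) := by ring
      _ ≤ 1 := hηF
  have hgrad_le : ∀ s, 1 ≤ s → s ≤ t → ‖gradient f (x s)‖ ≤ G t := by
    intro s hs hst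
    rw [hG]
    exact le_biSup_finset_of_nonneg (a := fun j => ‖gradient f (x j)‖)
      (fun _ => norm_nonneg _) _ (Finset.mem_Icc.2 ⟨hs, hst⟩)
  have hG_nonneg : 0 ≤ G t := (norm_nonneg _).trans (hgrad_le 1 le_rfl ht1)
  have hMt_nonneg : 0 ≤ Mt t := by
    rw [hMt, hLx]
    positivity
  have hincr : ∀ s, 1 ≤ s → s < t →
      ‖gradient f (x (s + 1)) - gradient f (x s)‖ ≤ Mt t := by
    intro s hs hst
    have hdist : ‖x s - x (s + 1)‖ ≤ tC0 * R := by
      rw [norm_sub_rev]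
      exact hstep s hs
    refine (hsmooth _ _ (hdist.trans hradius)).trans ?_
    calc (L0 + Lq * ‖gradient f (x s)‖ ^ q) * ‖x s - x (s + 1)‖
        ≤ (L0 + Lq * G t ^ q) * (tC0 * R) := by
          gcongr
          exact hgrad_le s hs hst.le
      _ = Mt t := by rw [hMt, hLx]; ring
  have hbound : ∀ s ∈ Finset.Icc 1 t, ‖gradient f (x s)‖ ≤ ‖gradient f (x 1)‖ + t * Mt t := by
    intro s hs
    obtain ⟨hs1, hst⟩ := Finset.mem_Icc.1 hs
    refine (norm_le_add_mul_of_norm_sub_le (y := fun s => gradient f (x s)) hincr hs1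
      hst).trans ?_
    have : (s : ℝ) ≤ t := by exact_mod_cast hst
    gcongr
    linarith
  set A : ℝ := ‖gradient f (x 1)‖ + t * Mt t
  have hMT1 : 1 ≤ MT ^ 2 := by
    have hT' : (1 : ℝ) ≤ T := by exact_mod_cast hT
    have hlog : 1 ≤ Real.log (Real.exp 1 * T / δ) := by
      rw [Real.le_log_iff_exp_le (by positivity), le_div_iff₀ hδ0]
      gcongr
      linarith
    rw [hMT, Real.sq_sqrt (by linarith)]
    exact hlog
  have hterm : ∀ s ∈ Finset.Icc 1 t,
      g s i ^ 2 ≤ 2 * MT ^ 2 * (σ0 ^ 2 + σ1 ^ 2 * A ^ p + A ^ 2) := by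
    intro s hs
    have hgA := hbound s hs
    obtain ⟨hs1, hst⟩ := Finset.mem_Icc.1 hs
    have hnoise_s := hnoise s (Finset.mem_Icc.2 ⟨hs1, hst.trans htT⟩)
    have hgs : ‖g s‖ ≤ ‖ξ s‖ + ‖gradient f (x s)‖ := by
      have : g s = ξ s + gradient f (x s) := by rw [hξ, sub_add_cancel]
      rw [this]
      exact norm_add_le _ _
    calc g s i ^ 2 = ‖g s i‖ ^ 2 := by rw [Real.norm_eq_abs, sq_abs]
      _ ≤ (‖ξ s‖ + ‖gradient f (x s)‖) ^ 2 := by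
          gcongr
          exact (PiLp.norm_apply_le (g s) i).trans hgs
      _ ≤ 2 * (‖ξ s‖ ^ 2 + ‖gradient f (x s)‖ ^ 2) := add_sq_le
      _ ≤ 2 * (MT ^ 2 * (σ0 ^ 2 + σ1 ^ 2 * ‖gradient f (x s)‖ ^ p) +
            MT ^ 2 * ‖gradient f (x s)‖ ^ 2) := by
          gcongr
          exact le_mul_of_one_le_left (by positivity) hMT1
      _ ≤ 2 * (MT ^ 2 * (σ0 ^ 2 + σ1 ^ 2 * A ^ p) + MT ^ 2 * A ^ 2) := by gcongr
      _ = 2 * MT ^ 2 * (σ0 ^ 2 + σ1 ^ 2 * A ^ p + A ^ 2) := by ring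
  have hsum : ∑ s ∈ Finset.Icc 1 t, g s i ^ 2 ≤
      t * (2 * MT ^ 2 * (σ0 ^ 2 + σ1 ^ 2 * A ^ p + A ^ 2)) := by
    simpa using Finset.sum_le_card_nsmul _ _ _ hterm
  calc 1 + 1 / ε ^ 2 * ∑ s ∈ Finset.Icc 1 t, g s i ^ 2
      ≤ 1 + 1 / ε ^ 2 * (t * (2 * MT ^ 2 * (σ0 ^ 2 + σ1 ^ 2 * A ^ p + A ^ 2))) := by gcongr
    _ = _ := by ring
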